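/- Let B be a reduced commutative ℂ-algebra of finite type, let M be an invertible (rank-one finitely generated projective) B-module, and let 0 → M → E →^r P¹_{B/ℂ}(M) → 0 be an extension of B-modules. Let E′ = E ×_{P¹_{B/ℂ}(M)} (Ω_{B/ℂ} ⊗_B M) be the pullback of this extension along the canonical inclusion i : Ω_{B/ℂ} ⊗_B M → P¹_{B/ℂ}(M), with induced map i′ : E′ → E; let E″ = E′ ⊗_B M⁻¹, an extension of Ω_{B/ℂ} by B; and let O = B ×_{Ω_{B/ℂ}} E″ be the associated commutative ℂ-algebra with multiplication (f,a)(f′,a′) = (ff′, fa′ + f′a). Then the fiber product 𝓛 = M ×_{P¹_{B/ℂ}(M)} E = {(s, e) ∈ M ⊕ E : p₁(s) = r(e)}, with the action (f, a)·(s, e) = (fs, fe + i′(a·s)) for (f,a) ∈ O (where a·s ∈ E″ ⊗_B M = E′), is a well-defined O-module, and 𝓛 is an invertible O-module with 𝓛 ⊗_O B ≅ M. -/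

import Mathlib

open TensorProduct

noncomputable section

section JetInfrastructure

variable (A R : Type*) [CommRing A] [CommRing R] [Algebra A R]

/-- The ring of one-jets `(R ⊗[A] R) ⧸ I²`, an `R`-algebra via the left tensor factor,
where `I` is the kernel of the multiplication map `R ⊗[A] R → R`. -/
abbrev JetAlgebra := (R ⊗[A] R) ⧸ (KaehlerDifferential.ideal A R ^ 2)

/-- `(R ⊗[A] R) ⧸ I²` regarded as an `R`-module via the *right* tensor factor. -/
def JetRight : Type _ := JetAlgebra A R

instance : AddCommGroup (JetRight A R) := inferInstanceAs (AddCommGroup (JetAlgebra A R))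

/-- The right inclusion `R → (R ⊗[A] R)/I²`, `r ↦ [1 ⊗ r]`. -/
def jetRightHom : R →+* JetAlgebra A R :=
  (Ideal.Quotient.mk (KaehlerDifferential.ideal A R ^ 2)).comp
    (Algebra.TensorProduct.includeRight (R := A) (A := R) (B := R)).toRingHom

/-- The right-factor `R`-module structure. -/
instance : Module R (JetRight A R) :=
  Module.compHom (JetAlgebra A R) (jetRightHom A R)

instance : Module (JetAlgebra A R) (JetRight A R) :=
  inferInstanceAs (Module (JetAlgebra A R) (JetAlgebra A R))

instance : SMulCommClass R (JetAlgebra A R) (JetRight A R) := by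
  constructor
  intro r q x
  show jetRightHom A R r * (q * (show JetAlgebra A R from x)) =
    q * (jetRightHom A R r * (show JetAlgebra A R from x))
  ring

variable (N : Type*) [AddCommGroup N] [Module R N]

/-- The module of one-jets `P¹_{R/A}(N) = ((R ⊗[A] R)/I²) ⊗[R] N`, the tensor product
being taken with respect to the right-factor `R`-module structure of `(R ⊗[A] R)/I²`. -/
def JetModule : Type _ := JetRight A R ⊗[R] N

instance : AddCommGroup (JetModule A R N) :=
  inferInstanceAs (AddCommGroup (JetRight A R ⊗[R] N))

instance : Module (JetAlgebra A R) (JetModule A R N) :=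
  inferInstanceAs (Module (JetAlgebra A R) (JetRight A R ⊗[R] N))

/-- The *left* `R`-module structure on `P¹_{R/A}(N)`, via the left tensor factor. -/
instance : Module R (JetModule A R N) :=
  Module.compHom (JetRight A R ⊗[R] N) (algebraMap R (JetAlgebra A R))

variable {A R N}

/-- The class of `x ⊗ n` in `P¹_{R/A}(N)`. -/
def JetModule.mk (x : R ⊗[A] R) (n : N) : JetModule A R N :=
  (show JetRight A R from
    Ideal.Quotient.mk (KaehlerDifferential.ideal A R ^ 2) x) ⊗ₜ[R] n

/-- The one-jet map `p₁ : N → P¹_{R/A}(N)`, `n ↦ [1 ⊗ 1] ⊗ n`. -/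
def jetOne (A : Type*) [CommRing A] {R N : Type*} [CommRing R] [Algebra A R]
    [AddCommGroup N] [Module R N] (n : N) : JetModule A R N :=
  JetModule.mk (1 : R ⊗[A] R) n

end JetInfrastructure

/-- An invertible module: a rank-one finitely generated projective module. -/
def IsInvertibleModule (R M : Type*) [CommRing R] [AddCommGroup M] [Module R M] : Prop :=
  Module.Finite R M ∧ Module.Projective R M ∧
    ∀ (p : Ideal R) (hp : p.IsPrime),
      Module.finrank (Localization (p.primeCompl (hp := hp)))
        (LocalizedModule (p.primeCompl (hp := hp)) M) = 1

/-- The pullback `E′ = E ×_{P¹_{B/ℂ}(M)} (Ω_{B/ℂ} ⊗_B M)` of an extension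
`r : E → P¹_{B/ℂ}(M)` along the canonical inclusion `i : Ω_{B/ℂ} ⊗_B M → P¹_{B/ℂ}(M)`,
as a submodule of `E × (Ω_{B/ℂ} ⊗_B M)`. -/
def pullbackAlongI {B M E : Type*} [CommRing B] [Algebra ℂ B]
    [AddCommGroup M] [Module B M] [AddCommGroup E] [Module B E]
    (r : E →ₗ[B] JetModule ℂ B M) (i : (Ω[B⁄ℂ] ⊗[B] M) →ₗ[B] JetModule ℂ B M) :
    Submodule B (E × (Ω[B⁄ℂ] ⊗[B] M)) :=
  LinearMap.ker (r ∘ₗ LinearMap.fst B E (Ω[B⁄ℂ] ⊗[B] M) -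
    i ∘ₗ LinearMap.snd B E (Ω[B⁄ℂ] ⊗[B] M))

/-- The fiber product `O = B ×_{Ω_{B/ℂ}} E″ = {(f, a) ∈ B × E″ : h″(a) = df}`. -/
abbrev FibAlg (B E : Type*) [CommRing B] [Algebra ℂ B] [AddCommGroup E] [Module B E]
    (h : E →ₗ[B] Ω[B⁄ℂ]) : Type _ :=
  {p : B × E // h p.2 = KaehlerDifferential.D ℂ B p.1}

theorem IsInvertibleModule.smul_comm {B M : Type*} [CommRing B] [AddCommGroup M] [Module B M]
    (hM : IsInvertibleModule B M) (φ : Module.Dual B M) (s m : M) : φ s • m = φ m • s := by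
  obtain ⟨_, _, hrank⟩ := hM
  refine Module.eq_of_localization_maximal (R := B) (M := M)
    (fun P _ => LocalizedModule P.primeCompl M)
    (fun P _ => LocalizedModule.mkLinearMap P.primeCompl M) _ _ fun P hP => ?_
  have : Module.Free (Localization P.primeCompl) (LocalizedModule P.primeCompl M) :=
    Module.free_of_flat_of_isLocalRing
  obtain ⟨b, -, hb⟩ := finrank_eq_one_iff'.1 (hrank P hP.isPrime)
  let ψ : LocalizedModule P.primeCompl M →ₗ[Localization P.primeCompl] Localization P.primeCompl :=
    (IsLocalizedModule.map P.primeCompl (LocalizedModule.mkLinearMap P.primeCompl M)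
      (Algebra.linearMap B (Localization P.primeCompl)) φ).extendScalarsOfIsLocalization
        P.primeCompl (Localization P.primeCompl)
  have hψ (x : M) : ψ (LocalizedModule.mkLinearMap P.primeCompl M x) =
      algebraMap B (Localization P.primeCompl) (φ x) :=
    IsLocalizedModule.map_apply P.primeCompl (LocalizedModule.mkLinearMap P.primeCompl M)
      (Algebra.linearMap B (Localization P.primeCompl)) φ x
  obtain ⟨u, hu⟩ := hb (LocalizedModule.mkLinearMap P.primeCompl M s)
  obtain ⟨v, hv⟩ := hb (LocalizedModule.mkLinearMap P.primeCompl M m)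
  rw [map_smul, map_smul, algebra_compatible_smul (Localization P.primeCompl) (φ s),
    algebra_compatible_smul (Localization P.primeCompl) (φ m), ← hψ, ← hψ, ← hu, ← hv]
  simp only [map_smul, smul_smul, smul_eq_mul]
  congr 1
  ring

theorem IsInvertibleModule.span_dual_eq_top {B M : Type*} [CommRing B] [AddCommGroup M]
    [Module B M] (hM : IsInvertibleModule B M) :
    Ideal.span {b : B | ∃ (φ : Module.Dual B M) (m : M), φ m = b} = ⊤ := by
  obtain ⟨hfin, hproj, hrank⟩ := hM
  by_contra hne
  obtain ⟨P, hP, hle⟩ := Ideal.exists_le_maximal _ hne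
  obtain ⟨g, hg⟩ := Module.projective_def'.1 hproj
  have hmem : (⊤ : Submodule B M) ≤ P • ⊤ := fun m _ => by
    have := LinearMap.congr_fun hg m
    rw [LinearMap.comp_apply, LinearMap.id_apply, Finsupp.linearCombination_apply] at this
    rw [← this]
    refine Submodule.sum_mem _ fun x _ => Submodule.smul_mem_smul (hle ?_) trivial
    exact Ideal.subset_span ⟨Finsupp.lapply x ∘ₗ g, m, rfl⟩
  obtain ⟨c, hc, hc0⟩ := Submodule.exists_sub_one_mem_and_smul_eq_zero_of_fg_of_le_smul P ⊤
    hfin.fg_top hmem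
  have hcP : c ∉ P := fun h => hP.ne_top <| P.eq_top_iff_one.2 <| by
    simpa using P.sub_mem h hc
  have : Subsingleton (LocalizedModule P.primeCompl M) :=
    LocalizedModule.subsingleton_iff.2 fun m => ⟨c, hcP, hc0 m trivial⟩
  have h1 := hrank P hP.isPrime
  rw [Module.finrank_zero_of_subsingleton] at h1
  exact zero_ne_one h1

/-- A module which is generated by one element, freely, up to multiplication by `c`,
for `c` ranging over a set generating the unit ideal, is invertible. -/
theorem isInvertibleModule_of_span_eq_top {O L : Type*} [CommRing O] [AddCommGroup L] [Module O L]
    (T : Set O) (hT : Ideal.span T = ⊤)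
    (h : ∀ c ∈ T, ∃ x : L, (∀ y : L, ∃ o : O, c • y = o • x) ∧ ∀ o : O, o • x = 0 → c * o = 0) :
    IsInvertibleModule O L := by
  have hdual (c : O) (hc : c ∈ T) : ∃ (x : L) (ψ : L →ₗ[O] O), ∀ y, ψ y • x = (c * c) • y := by
    obtain ⟨x, hx, hx0⟩ := h c hc
    choose g hg using hx
    have key (o o' : O) (heq : o • x = o' • x) : c * o = c * o' := by
      have := hx0 (o - o') (by rw [sub_smul, heq, sub_self])
      rwa [mul_sub, sub_eq_zero] at this
    refine ⟨x, ⟨⟨fun y => c * g y, fun y z => ?_⟩, fun b y => ?_⟩, fun y => ?_⟩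
    · rw [← mul_add]
      apply key
      rw [add_smul, ← hg, ← hg, ← hg, smul_add]
    · rw [RingHom.id_apply, smul_eq_mul, mul_left_comm]
      apply key
      rw [mul_smul, ← hg, ← hg, smul_comm]
    · change (c * g y) • x = _
      rw [mul_smul, ← hg, mul_smul]
  have hT2 : Ideal.span ((fun c => c * c) '' T) = ⊤ := by
    by_contra hne
    obtain ⟨P, hP, hle⟩ := Ideal.exists_le_maximal _ hne
    refine hP.ne_top (top_le_iff.1 (hT ▸ Ideal.span_le.2 fun c hc => ?_))
    exact (or_self_iff).1 (hP.isPrime.mem_or_mem (hle (Ideal.subset_span ⟨c, hc, rfl⟩)))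
  choose! x ψ hxψ using hdual
  obtain ⟨w, hw⟩ := (Finsupp.mem_ideal_span_range_iff_exists_finsupp
    (v := fun c : T => (c : O) * c) (x := (1 : O))).1 (by
      rw [show Set.range (fun c : T => (c : O) * c) = (fun c => c * c) '' T by
        ext; simp, hT2]
      trivial)
  let p : (w.support → O) →ₗ[O] L := Fintype.linearCombination O fun c => x (c : T)
  let s : L →ₗ[O] (w.support → O) := LinearMap.pi fun c => w c • ψ (c : T)
  have hps : p ∘ₗ s = LinearMap.id := by
    ext y
    simp only [p, s, LinearMap.comp_apply, Fintype.linearCombination_apply, LinearMap.pi_apply,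
      LinearMap.smul_apply, LinearMap.id_apply]
    have : ∀ c : w.support, (w c • ψ ((c : T) : O) y) • x ((c : T) : O) =
        (w c * ((c : T) * (c : T) : O)) • y := fun c => by
      rw [smul_assoc, hxψ _ (c : T).2, smul_smul]
    simp_rw [this]
    rw [← Finset.sum_smul, Finset.sum_coe_sort w.support fun c : T => w c * ((c : O) * c)]
    simp only [Finsupp.sum] at hw
    rw [hw, one_smul]
  refine ⟨Module.Finite.of_surjective p fun y => ⟨s y, LinearMap.congr_fun hps y⟩,
    Module.Projective.of_split s p hps, fun P hP => ?_⟩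
  obtain ⟨c, hcT, hcP⟩ : ∃ c ∈ T, c ∉ P := by
    by_contra! hall
    exact hP.ne_top (top_le_iff.1 (hT ▸ Ideal.span_le.2 hall))
  obtain ⟨x, hx, hx0⟩ := h c hcT
  let f : Localization P.primeCompl →ₗ[Localization P.primeCompl] LocalizedModule P.primeCompl L :=
    LinearMap.toSpanSingleton _ _ (LocalizedModule.mk x 1)
  have hf (o : O) (t : P.primeCompl) :
      f (Localization.mk o t) = LocalizedModule.mk (o • x) t := by
    simp [f, LocalizedModule.mk_smul_mk]
  have hbij : Function.Bijective f := by
    constructor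
    · rw [injective_iff_map_eq_zero]
      intro z
      induction z using Localization.induction_on with | _ z => ?_
      obtain ⟨o, t⟩ := z
      intro hz
      rw [hf, ← LocalizedModule.zero_mk 1, LocalizedModule.mk_eq] at hz
      obtain ⟨u, hu⟩ := hz
      rw [one_smul, smul_zero, smul_zero, Submonoid.smul_def, smul_smul] at hu
      rw [Localization.mk_eq_mk', IsLocalization.mk'_eq_zero_iff]
      exact ⟨⟨c, hcP⟩ * u, by simpa [mul_assoc] using hx0 _ hu⟩
    · intro z
      induction z using LocalizedModule.induction_on with | _ y t => ?_
      obtain ⟨o, ho⟩ := hx y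
      refine ⟨Localization.mk o (⟨c, hcP⟩ * t), ?_⟩
      rw [hf, ← ho]
      exact LocalizedModule.mk_cancel_common_left ⟨c, hcP⟩ t y
  rw [← (LinearEquiv.ofBijective f hbij).finrank_eq, Module.finrank_self]

/-- Base change along a surjection `O → B` of an `O`-module `L` with a semilinear surjection
onto a `B`-module `M` with kernel `ker (O → B) • L` is `M`. -/
theorem exists_baseChange_equiv_of_ker_le {O B L M : Type*} [CommRing O] [CommRing B]
    [Algebra O B] [AddCommGroup L] [Module O L] [AddCommGroup M] [Module B M]
    (hπ : Function.Surjective (algebraMap O B)) (g : L →+ M)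
    (hg : ∀ (o : O) (x : L), g (o • x) = algebraMap O B o • g x) (hgs : Function.Surjective g)
    (hker : ∀ x, g x = 0 → x ∈ RingHom.ker (algebraMap O B) • (⊤ : Submodule O L)) :
    ∃ eq : (B ⊗[O] L) ≃ₗ[B] M, ∀ x : L, eq ((1 : B) ⊗ₜ x) = g x := by
  let : Module O M := Module.compHom M (algebraMap O B)
  have : IsScalarTower O B M := ⟨fun o b m => by
    rw [Algebra.smul_def, mul_smul]; rfl⟩
  let g' : L →ₗ[O] M := { g with map_smul' := hg }
  let G : B ⊗[O] L →ₗ[B] M := g'.liftBaseChange B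
  have hG (x : L) : G (1 ⊗ₜ x) = g x := by
    simp [G, g']
  have hrep (z : B ⊗[O] L) : ∃ x : L, z = 1 ⊗ₜ x := by
    induction z with
    | zero => exact ⟨0, by simp⟩
    | tmul b x =>
      obtain ⟨o, rfl⟩ := hπ b
      exact ⟨o • x, by rw [← TensorProduct.smul_tmul, Algebra.smul_def, mul_one]⟩
    | add z w hz hw =>
      obtain ⟨x, rfl⟩ := hz
      obtain ⟨y, rfl⟩ := hw
      exact ⟨x + y, by rw [TensorProduct.tmul_add]⟩
  refine ⟨LinearEquiv.ofBijective G ⟨?_, fun m => ?_⟩, hG⟩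
  · rw [injective_iff_map_eq_zero]
    intro z hz
    obtain ⟨x, rfl⟩ := hrep z
    rw [hG] at hz
    refine Submodule.smul_induction_on (p := fun y => (1 : B) ⊗ₜ[O] y = 0) (hker x hz) ?_ ?_
    · intro o ho y _
      rw [← TensorProduct.smul_tmul, Algebra.smul_def, mul_one, (RingHom.mem_ker).1 ho,
        TensorProduct.zero_tmul]
    · intro y z hy hz
      rw [TensorProduct.tmul_add, hy, hz, add_zero]
  · obtain ⟨x, rfl⟩ := hgs m
    exact ⟨1 ⊗ₜ x, hG x⟩

/-- The fibre product `{(s, e) : p₁ s = r e}` as an invertible module over an algebra `O` which is,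
via `p ↦ (π p, α p)`, the fibre product `{(f, a) ∈ B × Q : h a = D f}`. -/
theorem exists_isInvertibleModule_fiberProduct {O B M E Ω J Q : Type*} [CommRing O] [CommRing B]
    [AddCommGroup M] [Module B M] (hM : IsInvertibleModule B M) [AddCommGroup E] [Module B E]
    [AddCommGroup Ω] [Module B Ω] [AddCommGroup J] [Module B J] [AddCommGroup Q] [Module B Q]
    (p₁ : M → J) (i : Ω ⊗[B] M →ₗ[B] J) (r : E →ₗ[B] J) (D : B → Ω) (h : Q →ₗ[B] Ω)
    (act : Q →ₗ[B] M →ₗ[B] E) (π : O →+* B) (α : O → Q)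
    (hp_add : ∀ s t, p₁ (s + t) = p₁ s + p₁ t)
    (hp_smul : ∀ f s, p₁ (f • s) = i (D f ⊗ₜ s) + f • p₁ s)
    (hr : Function.Surjective r) (hD : D 0 = 0)
    (hact : ∀ a s, r (act a s) = i (h a ⊗ₜ s)) (hh : Function.Surjective h)
    (hact_inj : ∀ (φ : Module.Dual B M) (s : M) (a : Q), h a = 0 → act a s = 0 → φ s • a = 0)
    (hact_surj : ∀ (e : E), r e = 0 → ∀ φ : Module.Dual B M,
      ∃ a, h a = 0 ∧ ∀ m, act a m = φ m • e)
    (hα : ∀ o, h (α o) = D (π o)) (hO : ∀ f a, h a = D f → ∃ o, π o = f ∧ α o = a)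
    (hO_ext : ∀ o o', π o = π o' → α o = α o' → o = o') (hα_one : α 1 = 0)
    (hα_add : ∀ o o', α (o + o') = α o + α o')
    (hα_mul : ∀ o o', α (o * o') = π o • α o' + π o' • α o) :
    ∃ (addL : AddCommGroup {p : M × E // p₁ p.1 = r p.2})
      (modL : Module O {p : M × E // p₁ p.1 = r p.2}),
      (∀ p q : {p : M × E // p₁ p.1 = r p.2}, (p + q).val = p.val + q.val) ∧
      ((0 : {p : M × E // p₁ p.1 = r p.2}).val = 0) ∧
      (∀ (o : O) (s : {p : M × E // p₁ p.1 = r p.2}),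
        (o • s).val = (π o • s.val.1, π o • s.val.2 + act (α o) s.val.1)) ∧
      IsInvertibleModule O {p : M × E // p₁ p.1 = r p.2} ∧
      (letI : Algebra O B := π.toAlgebra
      ∃ eq : (B ⊗[O] {p : M × E // p₁ p.1 = r p.2}) ≃ₗ[B] M,
        ∀ s : {p : M × E // p₁ p.1 = r p.2}, eq ((1 : B) ⊗ₜ s) = s.val.1) := by
  have hp_zero : p₁ 0 = 0 := by simpa using hp_add 0 0
  have hp_neg (s : M) : p₁ (-s) = -p₁ s :=
    eq_neg_of_add_eq_zero_left (by rw [← hp_add, neg_add_cancel, hp_zero])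
  have hα_zero : α 0 = 0 := by simpa using hα_add 0 0
  let K : AddSubgroup (M × E) :=
    { carrier := {p | p₁ p.1 = r p.2}
      add_mem' := fun {x y} hx hy => by
        simp only [Set.mem_ofPred_eq] at hx hy ⊢
        simp [hp_add, hx, hy]
      zero_mem' := by simp [hp_zero]
      neg_mem' := fun {x} hx => by
        simp only [Set.mem_ofPred_eq] at hx ⊢
        simp [hp_neg, hx] }
  let addL : AddCommGroup {p : M × E // p₁ p.1 = r p.2} := K.toAddCommGroup
  have val_add (p q : {p : M × E // p₁ p.1 = r p.2}) : (p + q).val = p.val + q.val := rfl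
  have val_zero : (0 : {p : M × E // p₁ p.1 = r p.2}).val = 0 := rfl
  let smulL : SMul O {p : M × E // p₁ p.1 = r p.2} :=
    ⟨fun o s => ⟨(π o • s.val.1, π o • s.val.2 + act (α o) s.val.1), by
      rw [hp_smul, map_add, map_smul, hact, hα, s.2, add_comm]⟩⟩
  have val_smul (o : O) (s : {p : M × E // p₁ p.1 = r p.2}) :
      (o • s).val = (π o • s.val.1, π o • s.val.2 + act (α o) s.val.1) := rfl
  let modL : Module O {p : M × E // p₁ p.1 = r p.2} :=
    { one_smul := fun s => Subtype.ext <| by simp [val_smul, hα_one]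
      mul_smul := fun o o' s => Subtype.ext <| by
        simp only [val_smul, map_mul, hα_mul, map_add, map_smul, LinearMap.add_apply,
          LinearMap.smul_apply, mul_smul, smul_add, Prod.mk.injEq, true_and]
        abel
      smul_zero := fun o => Subtype.ext <| by simp [val_smul, val_zero]
      smul_add := fun o s t => Subtype.ext <| by
        simp only [val_smul, val_add, Prod.fst_add, Prod.snd_add, smul_add, map_add,
          Prod.mk_add_mk, Prod.mk.injEq, true_and]
        abel
      add_smul := fun o o' s => Subtype.ext <| by
        simp only [val_smul, val_add, hα_add, map_add, add_smul, LinearMap.add_apply,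
          Prod.mk_add_mk, Prod.mk.injEq, true_and]
        abel
      zero_smul := fun s => Subtype.ext <| by simp [val_smul, val_zero, hα_zero] }
  have hπ : Function.Surjective π := fun f => by
    obtain ⟨a, ha⟩ := hh (D f)
    obtain ⟨o, ho, -⟩ := hO f a ha
    exact ⟨o, ho⟩
  have exists_lift (s : M) : ∃ x : {p : M × E // p₁ p.1 = r p.2}, x.val.1 = s := by
    obtain ⟨e, he⟩ := hr (p₁ s)
    exact ⟨⟨(s, e), he.symm⟩, rfl⟩
  -- the kernel of the projection to `M` is reached by the kernel of `π`
  have hker (φ : Module.Dual B M) (y : {p : M × E // p₁ p.1 = r p.2}) (hy : y.val.1 = 0) :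
      ∃ o : O, π o = 0 ∧ ∀ x : {p : M × E // p₁ p.1 = r p.2},
        (o • x).val = (0, φ x.val.1 • y.val.2) := by
    obtain ⟨a, ha, ham⟩ := hact_surj y.val.2 (by rw [← y.2, hy, hp_zero]) φ
    obtain ⟨o, ho, rfl⟩ := hO 0 a (by rw [ha, hD])
    exact ⟨o, ho, fun x => by rw [val_smul, ho, ham, zero_smul, zero_smul, zero_add]⟩
  have val_smul_of_fst (o : O) (y : {p : M × E // p₁ p.1 = r p.2}) (hy : y.val.1 = 0) :
      (o • y).val = (0, π o • y.val.2) := by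
    rw [val_smul, hy, smul_zero, map_zero, add_zero]
  refine ⟨addL, modL, val_add, val_zero, val_smul, ?_, ?_⟩
  · refine isInvertibleModule_of_span_eq_top
      {c : O | ∃ (φ : Module.Dual B M) (s : M) (F : O), π F = φ s ∧ F * F = c} ?_ ?_
    · by_contra hne
      obtain ⟨P, hP, hle⟩ := Ideal.exists_le_maximal _ hne
      have h1 : (1 : B) ∈ P.map π := by
        suffices P.map π = ⊤ by rw [this]; trivial
        rw [eq_top_iff, ← hM.span_dual_eq_top, Ideal.span_le]
        rintro _ ⟨φ, s, rfl⟩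
        obtain ⟨F, hF⟩ := hπ (φ s)
        rw [← hF]
        exact Ideal.mem_map_of_mem π ((or_self_iff).1 (hP.isPrime.mem_or_mem
          (hle (Ideal.subset_span ⟨φ, s, F, hF, rfl⟩))))
      obtain ⟨F, hFP, hF⟩ := (Ideal.mem_map_iff_of_surjective π hπ).1 h1
      have hsq : (1 - F) * (1 - F) = 0 := by
        have h0 : π (1 - F) = 0 := by rw [map_sub, hF, map_one, sub_self]
        exact hO_ext _ _ (by rw [map_mul, h0, mul_zero, map_zero])
          (by rw [hα_mul, h0, zero_smul, add_zero, hα_zero])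
      have hmem : 1 - F ∈ P := (or_self_iff).1 (hP.isPrime.mem_or_mem (hsq ▸ P.zero_mem))
      exact hP.ne_top (P.eq_top_iff_one.2 (by simpa using P.add_mem hmem hFP))
    · rintro _ ⟨φ, s, F, hF, rfl⟩
      obtain ⟨x, rfl⟩ := exists_lift s
      refine ⟨x, fun y => ?_, fun o ho => ?_⟩
      · obtain ⟨G, hG⟩ := hπ (φ y.val.1)
        have hz : (F • y - G • x).val.1 = 0 := by
          rw [sub_eq_add_neg, ← neg_smul, val_add, val_smul, val_smul, Prod.fst_add, hF, map_neg,
            hG, hM.smul_comm φ x.val.1, neg_smul, add_neg_cancel]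
        obtain ⟨o, -, ho⟩ := hker φ _ hz
        refine ⟨F * G + o, ?_⟩
        rw [add_smul, mul_smul, mul_smul, ← sub_eq_iff_eq_add', ← smul_sub]
        exact Subtype.ext (by rw [val_smul_of_fst F _ hz, ho, hF])
      · have hFo : π (F * o) = 0 := by
          have := congrArg (fun z => φ z.val.1) ho
          simp only [val_smul, val_zero, map_smul, Prod.fst_zero, map_zero, smul_eq_mul] at this
          rw [map_mul, hF, mul_comm, this]
        have hzero : act (α (F * o)) x.val.1 = 0 := by
          have : (F * o) • x = 0 := by rw [mul_smul, ho, smul_zero]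
          simpa [val_smul, val_zero, hFo] using congrArg (fun z => z.val.2) this
        have := hact_inj φ x.val.1 (α (F * o)) (by rw [hα, hFo, hD]) hzero
        rw [mul_assoc]
        exact hO_ext _ _ (by rw [map_mul, hFo, mul_zero, map_zero])
          (by rw [hα_mul, hFo, zero_smul, add_zero, hF, this, hα_zero])
  · let : Algebra O B := π.toAlgebra
    refine exists_baseChange_equiv_of_ker_le hπ
      ({ toFun := fun x => x.val.1, map_zero' := rfl, map_add' := fun _ _ => rfl } :
        {p : M × E // p₁ p.1 = r p.2} →+ M) (fun _ _ => rfl) exists_lift fun y hy => ?_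
    let I : Ideal B := Ideal.map π (Submodule.colon
      (RingHom.ker π • (⊤ : Submodule O {p : M × E // p₁ p.1 = r p.2})) {y})
    have h1 : (1 : B) ∈ I := by
      suffices I = ⊤ by rw [this]; trivial
      rw [eq_top_iff, ← hM.span_dual_eq_top, Ideal.span_le]
      rintro _ ⟨φ, s, rfl⟩
      obtain ⟨F, hF⟩ := hπ (φ s)
      obtain ⟨x, rfl⟩ := exists_lift s
      obtain ⟨o, ho0, ho⟩ := hker φ y hy
      rw [← hF]
      refine Ideal.mem_map_of_mem π (Submodule.mem_colon_singleton.2 ?_)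
      rw [show F • y = o • x from Subtype.ext (by rw [val_smul_of_fst F y hy, ho, hF])]
      exact Submodule.smul_mem_smul ho0 trivial
    obtain ⟨F, hFP, hF⟩ := (Ideal.mem_map_iff_of_surjective π hπ).1 h1
    have hFy : F • y = y := Subtype.ext <| by
      rw [val_smul_of_fst F y hy, hF, one_smul]
      exact Prod.ext hy.symm rfl
    rw [← hFy]
    exact Submodule.mem_colon_singleton.1 hFP

theorem jetOne_add (A : Type*) [CommRing A] {R N : Type*} [CommRing R] [Algebra A R]
    [AddCommGroup N] [Module R N] (m n : N) :
    (jetOne A (m + n) : JetModule A R N) = jetOne A m + jetOne A n :=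
  TensorProduct.tmul_add _ _ _

theorem jetOne_smul (A : Type*) [CommRing A] {R N : Type*} [CommRing R] [Algebra A R]
    [AddCommGroup N] [Module R N] (f : R) (n : N) :
    (jetOne A (f • n) : JetModule A R N) =
      JetModule.mk ((1 : R) ⊗ₜ[A] f - f ⊗ₜ[A] (1 : R)) n + f • jetOne A n := by
  have h₁ : (jetOne A (f • n) : JetModule A R N) = JetModule.mk ((1 : R) ⊗ₜ[A] f) n := by
    refine (TensorProduct.smul_tmul f _ n).symm.trans ?_
    refine congrArg (fun z : JetRight A R => z ⊗ₜ[R] n) ?_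
    exact mul_one (jetRightHom A R f)
  have h₂ : f • (jetOne A n : JetModule A R N) = JetModule.mk (f ⊗ₜ[A] (1 : R)) n := by
    refine congrArg (fun z : JetRight A R => z ⊗ₜ[R] n) ?_
    exact mul_one (algebraMap R (JetAlgebra A R) f)
  rw [h₁, h₂]
  refine Eq.trans ?_ (TensorProduct.add_tmul _ _ _)
  refine congrArg (fun z : JetRight A R => z ⊗ₜ[R] n) ?_
  exact (congrArg (Ideal.Quotient.mk _) (sub_add_cancel _ _).symm).trans
    (map_add (Ideal.Quotient.mk (KaehlerDifferential.ideal A R ^ 2)) _ _)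

/-- let `B` be a reduced commutative `ℂ`-algebra of finite type, `M` an
invertible `B`-module, and `0 → M → E →^r P¹_{B/ℂ}(M) → 0` an extension of `B`-modules.
Let `E′ = E ×_{P¹_{B/ℂ}(M)} (Ω_{B/ℂ} ⊗_B M)` (pullback along the canonical inclusion
`i`), let `E″ = E′ ⊗_B M⁻¹` (with `M⁻¹ = Hom_B(M, B)`), with `h″ : E″ → Ω_{B/ℂ}` induced
by the projection `E′ → Ω_{B/ℂ} ⊗_B M`, and let `O = B ×_{Ω_{B/ℂ}} E″` be the associated
commutative `ℂ`-algebra.  Then the fiber product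
`𝓛 = M ×_{P¹_{B/ℂ}(M)} E = {(s, e) : p₁(s) = r(e)}`, with the action
`(f,a)·(s,e) = (fs, fe + i′(a·s))`, is a well-defined `O`-module; it is an invertible
`O`-module with `𝓛 ⊗_O B ≅ M`. -/
theorem stmt12 (B M E : Type*) [CommRing B] [Algebra ℂ B] [IsReduced B]
    [Algebra.FiniteType ℂ B] [AddCommGroup M] [Module B M] (hM : IsInvertibleModule B M)
    [AddCommGroup E] [Module B E]
    (l : M →ₗ[B] E) (r : E →ₗ[B] JetModule ℂ B M)
    (hl : Function.Injective l) (hr : Function.Surjective r)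
    (hex : Function.Exact l r) :
    -- for the canonical inclusion `i : Ω_{B/ℂ} ⊗_B M → P¹_{B/ℂ}(M)`:
    ∀ i : (Ω[B⁄ℂ] ⊗[B] M) →ₗ[B] JetModule ℂ B M,
      (∀ (f : B) (m : M), i (KaehlerDifferential.D ℂ B f ⊗ₜ[B] m) =
        JetModule.mk ((1 : B) ⊗ₜ[ℂ] f - f ⊗ₜ[ℂ] (1 : B)) m) →
      -- for the map `h″ : E″ = E′ ⊗_B M⁻¹ → Ω_{B/ℂ}` induced by `E′ → Ω_{B/ℂ} ⊗_B M`: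
      ∀ h'' : (↥(pullbackAlongI r i) ⊗[B] Module.Dual B M) →ₗ[B] Ω[B⁄ℂ],
        (∀ (e : E) (ω : Ω[B⁄ℂ]) (m : M) (hq : (e, ω ⊗ₜ[B] m) ∈ pullbackAlongI r i)
          (φ : Module.Dual B M),
          h'' ((⟨(e, ω ⊗ₜ[B] m), hq⟩ : ↥(pullbackAlongI r i)) ⊗ₜ[B] φ) = φ m • ω) →
        -- for the evaluation pairing `E″ ⊗ M → E′`, `(q ⊗ φ) · m = φ(m)·q`:
        ∀ pair : (↥(pullbackAlongI r i) ⊗[B] Module.Dual B M) →ₗ[B]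
            M →ₗ[B] ↥(pullbackAlongI r i),
          (∀ (q : ↥(pullbackAlongI r i)) (φ : Module.Dual B M) (m : M),
            pair (q ⊗ₜ[B] φ) m = φ m • q) →
          -- for `O = B ×_{Ω_{B/ℂ}} E″` with its `ℂ`-algebra structure:
          ∀ (ringO : CommRing (FibAlg B (↥(pullbackAlongI r i) ⊗[B] Module.Dual B M) h''))
            (algO : Algebra ℂ (FibAlg B (↥(pullbackAlongI r i) ⊗[B] Module.Dual B M) h'')),
            (1 : FibAlg B (↥(pullbackAlongI r i) ⊗[B] Module.Dual B M) h'').val =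
              (1, 0) →
            (∀ p q : FibAlg B (↥(pullbackAlongI r i) ⊗[B] Module.Dual B M) h'',
              (p + q).val = p.val + q.val) →
            (∀ p q : FibAlg B (↥(pullbackAlongI r i) ⊗[B] Module.Dual B M) h'',
              (p * q).val =
                (p.val.1 * q.val.1, p.val.1 • q.val.2 + q.val.1 • p.val.2)) →
            -- and the projection `π : O → B`:
            ∀ π : FibAlg B (↥(pullbackAlongI r i) ⊗[B] Module.Dual B M) h'' →+* B,
              (∀ p, π p = p.val.1) →
              -- `𝓛 = {(s, e) ∈ M × E : p₁(s) = r(e)}` is a well-defined `O`-module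
              -- for the action `(f,a)·(s,e) = (f·s, f·e + i′(a·s))`:
              ∃ (addL : AddCommGroup {p : M × E // jetOne ℂ p.1 = r p.2})
                (modL : Module (FibAlg B (↥(pullbackAlongI r i) ⊗[B] Module.Dual B M) h'')
                  {p : M × E // jetOne ℂ p.1 = r p.2}),
                (∀ p q : {p : M × E // jetOne ℂ p.1 = r p.2},
                  (p + q).val = p.val + q.val) ∧
                ((0 : {p : M × E // jetOne ℂ p.1 = r p.2}).val = 0) ∧
                (∀ (o : FibAlg B (↥(pullbackAlongI r i) ⊗[B] Module.Dual B M) h'')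
                  (s : {p : M × E // jetOne ℂ p.1 = r p.2}),
                  (o • s).val =
                    (o.val.1 • s.val.1,
                      o.val.1 • s.val.2 + ((pair o.val.2) s.val.1).val.1)) ∧
                -- `𝓛` is an invertible `O`-module
                IsInvertibleModule
                  (FibAlg B (↥(pullbackAlongI r i) ⊗[B] Module.Dual B M) h'')
                  {p : M × E // jetOne ℂ p.1 = r p.2} ∧
                -- and `𝓛 ⊗_O B ≅ M`
                (letI : Algebra (FibAlg B (↥(pullbackAlongI r i) ⊗[B] Module.Dual B M) h'') B :=
                  π.toAlgebra
                ∃ eq : (B ⊗[FibAlg B (↥(pullbackAlongI r i) ⊗[B] Module.Dual B M) h'']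
                    {p : M × E // jetOne ℂ p.1 = r p.2}) ≃ₗ[B] M,
                  ∀ s : {p : M × E // jetOne ℂ p.1 = r p.2},
                    eq ((1 : B) ⊗ₜ s) = s.val.1) := by
  intro i hi h'' hh'' pair hpair ringO algO hone hadd hmul π hπ
  have mem_iff (x : E × (Ω[B⁄ℂ] ⊗[B] M)) : x ∈ pullbackAlongI r i ↔ r x.1 = i x.2 := by
    simp [pullbackAlongI, sub_eq_zero]
  have h_tmul (φ : Module.Dual B M) (s : M) (w : Ω[B⁄ℂ] ⊗[B] M) :
      ∀ (e : E) (hq : (e, w) ∈ pullbackAlongI r i),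
        h'' ((⟨(e, w), hq⟩ : ↥(pullbackAlongI r i)) ⊗ₜ[B] φ) ⊗ₜ[B] s = φ s • w := by
    induction w with
    | zero =>
      intro e hq
      have hq' : (e, (0 : Ω[B⁄ℂ]) ⊗ₜ[B] (0 : M)) ∈ pullbackAlongI r i := by
        rwa [TensorProduct.zero_tmul]
      have := hh'' e 0 0 hq' φ
      simp only [TensorProduct.zero_tmul, smul_zero] at this
      rw [this, TensorProduct.zero_tmul, smul_zero]
    | tmul ω m =>
      intro e hq
      rw [hh'', TensorProduct.smul_tmul, hM.smul_comm φ m s, TensorProduct.tmul_smul]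
    | add w₁ w₂ h₁ h₂ =>
      intro e hq
      obtain ⟨e₁, he₁⟩ := hr (i w₁)
      have hq₁ : (e₁, w₁) ∈ pullbackAlongI r i := (mem_iff _).2 he₁
      have hq₂ : (e - e₁, w₂) ∈ pullbackAlongI r i := (mem_iff _).2 <| by
        have := (mem_iff _).1 hq
        simp only [map_sub, map_add] at this ⊢
        rw [this, he₁, add_sub_cancel_left]
      have hsum : (⟨(e, w₁ + w₂), hq⟩ : ↥(pullbackAlongI r i)) =
          ⟨(e₁, w₁), hq₁⟩ + ⟨(e - e₁, w₂), hq₂⟩ := Subtype.ext (by simp)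
      rw [hsum, TensorProduct.add_tmul, map_add, TensorProduct.add_tmul, h₁, h₂, smul_add]
  have pair_snd (a : ↥(pullbackAlongI r i) ⊗[B] Module.Dual B M) (s : M) :
      (pair a s).val.2 = h'' a ⊗ₜ[B] s := by
    induction a with
    | zero => simp
    | tmul q φ => rw [hpair]; exact (h_tmul φ s q.val.2 q.val.1 q.2).symm
    | add a b ha hb =>
      rw [map_add, LinearMap.add_apply, map_add, TensorProduct.add_tmul, ← ha, ← hb]
      rfl
  have pair_tmul (φ : Module.Dual B M) (s : M)
      (a : ↥(pullbackAlongI r i) ⊗[B] Module.Dual B M) : pair a s ⊗ₜ[B] φ = φ s • a := by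
    induction a with
    | zero => simp
    | tmul q ψ =>
      rw [hpair, TensorProduct.smul_tmul, ← TensorProduct.tmul_smul]
      congr 1
      ext m
      have := congrArg ψ (hM.smul_comm φ s m)
      simp only [map_smul, smul_eq_mul, LinearMap.smul_apply] at this ⊢
      rw [this, mul_comm]
    | add a b ha hb =>
      rw [map_add, LinearMap.add_apply, TensorProduct.add_tmul, ha, hb, smul_add]
  obtain ⟨addL, modL, hL_add, hL_zero, hL_smul, hL_inv, hL_eq⟩ :=
    exists_isInvertibleModule_fiberProduct hM (jetOne ℂ) i r (KaehlerDifferential.D ℂ B) h''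
    (((LinearMap.fst B E (Ω[B⁄ℂ] ⊗[B] M) ∘ₗ (pullbackAlongI r i).subtype).compRight B).comp pair)
    π (fun o => o.val.2) (jetOne_add ℂ) (fun f s => by rw [jetOne_smul, hi]) hr (map_zero _)
    (fun a s => by rw [← pair_snd]; exact (mem_iff _).1 (pair a s).2)
    (fun ω => by
      have h1 : (1 : B) ∈ Submodule.comap (LinearMap.toSpanSingleton B _ ω)
          (LinearMap.range h'') := by
        refine (?_ : (⊤ : Ideal B) ≤ _) trivial
        rw [← hM.span_dual_eq_top, Ideal.span_le]
        rintro _ ⟨φ, m, rfl⟩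
        obtain ⟨e, he⟩ := hr (i (ω ⊗ₜ m))
        exact ⟨_, hh'' e ω m ((mem_iff _).2 he) φ⟩
      simpa using h1)
    (fun φ s a ha has => by
      have h0 : pair a s = 0 := Subtype.ext <| Prod.ext has <| by
        rw [pair_snd, ha, TensorProduct.zero_tmul]; rfl
      rw [← pair_tmul, h0, TensorProduct.zero_tmul])
    (fun e he φ => by
      have hq : (e, (0 : Ω[B⁄ℂ]) ⊗ₜ[B] (0 : M)) ∈ pullbackAlongI r i :=
        (mem_iff _).2 (by rw [TensorProduct.zero_tmul, map_zero, he])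
      refine ⟨(⟨_, hq⟩ : ↥(pullbackAlongI r i)) ⊗ₜ[B] φ, by rw [hh'', smul_zero], fun m => ?_⟩
      change (pair (_ ⊗ₜ[B] φ) m).val.1 = _
      rw [hpair]
      rfl)
    (fun o => by rw [hπ]; exact o.2)
    (fun f a ha => ⟨⟨(f, a), ha⟩, hπ _, rfl⟩)
    (fun o o' h₁ h₂ => Subtype.ext (Prod.ext (by rwa [hπ, hπ] at h₁) h₂))
    (congrArg Prod.snd hone) (fun o o' => congrArg Prod.snd (hadd o o'))
    (fun o o' => by rw [hπ, hπ]; exact congrArg Prod.snd (hmul o o'))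
  exact ⟨addL, modL, hL_add, hL_zero, fun o s => by rw [hL_smul, hπ]; rfl, hL_inv, hL_eq⟩
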